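/- The foliage representation recovers the graph: if G is a connected simple graph with foliage partition V̂, foliage graph Ĝ (classes adjacent iff some pair of representatives adjacent in G), type function T (assigning to each class one of: singleton, star, clique, independent set of twins), and axil set A (containing exactly the centers of star-type classes), then two vertices v ∈ V_i, w ∈ V_j (i ≠ j) are adjacent in G if and only if V_i and V_j are adjacent in Ĝ, and (T(V_i) = star ⟹ v ∈ A), and (T(V_j) = star ⟹ w ∈ A); and v, w in the same class V_i are adjacent iff T(V_i) = clique, or T(V_i) = star and v ∈ A or w ∈ A. -/

import Mathlib

namespace Foliage

variable {V : Type*}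

open Classical in
noncomputable def adjNum (G : SimpleGraph V) (v u : V) : ℕ :=
  if G.Adj v u then 1 else 0

def Rel (G : SimpleGraph V) (v w : V) : Prop :=
  G.Reachable v w ∧
    ∀ u₁ u₂ : V, u₁ ≠ v → u₁ ≠ w → u₂ ≠ v → u₂ ≠ w →
      adjNum G v u₁ * adjNum G w u₂ = adjNum G v u₂ * adjNum G w u₁

/-- The four possible types of a foliage class. -/
inductive FType
  | singleton
  | star
  | clique
  | indep
  deriving DecidableEq

lemma Rel.rfl' (G : SimpleGraph V) (v : V) : Rel G v v :=
  ⟨SimpleGraph.Reachable.refl v, fun _ _ _ _ _ _ => by ring⟩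

lemma Rel.symm' {G : SimpleGraph V} {v w : V} (h : Rel G v w) : Rel G w v :=
  ⟨h.1.symm, fun u₁ u₂ a b c d => by
    have := h.2 u₂ u₁ d c b a
    linarith⟩

lemma leaf_unique {G : SimpleGraph V} {x a b : V} (h : (G.neighborSet x).ncard = 1)
    (ha : G.Adj x a) (hb : G.Adj x b) : a = b := by
  obtain ⟨z, hz⟩ := Set.ncard_eq_one.1 h
  have h1 : a ∈ G.neighborSet x := ha
  have h2 : b ∈ G.neighborSet x := hb
  rw [hz] at h1 h2
  exact h1.trans h2.symm

lemma no_two_leaves [Fintype V] {G : SimpleGraph V} (hconn : G.Connected)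
    (hcard : 3 ≤ Fintype.card V) {v w : V} (hvw : G.Adj v w)
    (hv : (G.neighborSet v).ncard = 1) (hw : (G.neighborSet w).ncard = 1) : False := by
  classical
  have key : ∀ x, x = v ∨ x = w := by
    intro x
    have hr := (SimpleGraph.reachable_iff_reflTransGen v x).1 (hconn.preconnected v x)
    induction hr with
    | refl => exact Or.inl rfl
    | tail _ hbc ih =>
      rcases ih with rfl | rfl
      · exact Or.inr (leaf_unique hv hbc hvw)
      · exact Or.inl (leaf_unique hw hbc hvw.symm)
  have h1 : (Finset.univ : Finset V) ⊆ {v, w} := fun x _ => by simpa using key x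
  have h2 := Finset.card_le_card h1
  have h3 := Finset.card_le_two (a := v) (b := w)
  rw [Finset.card_univ] at h2
  omega

/-- The foliage representation recovers the original graph: adjacency in `G`
is determined by the foliage graph (adjacency of classes), the type function,
and the axil set. -/
theorem foliage_representation_recovers [Fintype V] (G : SimpleGraph V)
    (hconn : G.Connected) (hcard : 3 ≤ Fintype.card V)
    (A : Set V) (T : V → FType)
    (hTconst : ∀ v w : V, Rel G v w → T v = T w)
    (hsing : ∀ v : V, T v = FType.singleton ↔ ∀ x, Rel G v x → x = v)
    (hstar : ∀ v : V, T v = FType.star ↔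
      ((∃ x, Rel G v x ∧ x ≠ v) ∧
       ∃ c, Rel G v c ∧ ∀ x, Rel G v x → x ≠ c →
         (G.neighborSet x).ncard = 1 ∧ G.Adj x c))
    (hclique : ∀ v : V, T v = FType.clique ↔
      ((∃ x, Rel G v x ∧ x ≠ v) ∧
       (∀ x y, Rel G v x → Rel G v y → x ≠ y → G.Adj x y) ∧
       (∀ x y u, Rel G v x → Rel G v y → u ≠ x → u ≠ y →
         (G.Adj x u ↔ G.Adj y u))))
    (hindep : ∀ v : V, T v = FType.indep ↔
      ((∃ x, Rel G v x ∧ x ≠ v) ∧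
       (∀ x y, Rel G v x → Rel G v y → x ≠ y → ¬ G.Adj x y) ∧
       (∀ x y u, Rel G v x → Rel G v y → u ≠ x → u ≠ y →
         (G.Adj x u ↔ G.Adj y u))))
    (hA : ∀ c : V, c ∈ A ↔
      (T c = FType.star ∧
       ∀ x, Rel G c x → x ≠ c → (G.neighborSet x).ncard = 1 ∧ G.Adj x c)) :
    (∀ v w : V, ¬ Rel G v w →
      (G.Adj v w ↔
        ((∃ v' w', Rel G v v' ∧ Rel G w w' ∧ G.Adj v' w') ∧
         (T v = FType.star → v ∈ A) ∧ (T w = FType.star → w ∈ A)))) ∧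
    (∀ v w : V, Rel G v w → v ≠ w →
      (G.Adj v w ↔
        (T v = FType.clique ∨ (T v = FType.star ∧ (v ∈ A ∨ w ∈ A))))) := by
  have step : ∀ v v' w' : V, Rel G v v' → w' ≠ v → G.Adj v' w' →
      (T v = FType.star → v ∈ A) → G.Adj v w' := by
    intro v v' w' hr hne hadj hs
    cases hT : T v with
    | singleton => rwa [(hsing v).1 hT v' hr] at hadj
    | clique =>
      exact (((hclique v).1 hT).2.2 v' v w' hr (Rel.rfl' G v) hadj.ne' hne).1 hadj
    | indep =>
      exact (((hindep v).1 hT).2.2 v' v w' hr (Rel.rfl' G v) hadj.ne' hne).1 hadj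
    | star =>
      by_cases hvv : v' = v
      · rwa [hvv] at hadj
      · obtain ⟨h1, h2⟩ := ((hA v).1 (hs hT)).2 v' hr hvv
        exact absurd (leaf_unique h1 hadj h2) hne
  have axil : ∀ v w : V, ¬ Rel G v w → G.Adj v w → T v = FType.star → v ∈ A := by
    intro v w hn hadj hT
    obtain ⟨_, c, hc, hx⟩ := (hstar v).1 hT
    by_cases hvc : v = c
    · subst hvc
      exact (hA v).2 ⟨hT, hx⟩
    · obtain ⟨h1, h2⟩ := hx v (Rel.rfl' G v) hvc
      rw [leaf_unique h1 hadj h2] at hn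
      exact absurd hc hn
  refine ⟨fun v w hn => ⟨fun hadj => ⟨⟨v, w, Rel.rfl' G v, Rel.rfl' G w, hadj⟩,
    axil v w hn hadj, axil w v (fun h => hn h.symm') hadj.symm⟩, ?_⟩, fun v w hr hne => ⟨?_, ?_⟩⟩
  · rintro ⟨⟨v', w', hv, hw, hadj⟩, hsv, hsw⟩
    have h1 : G.Adj v w' := step v v' w' hv
      (fun h => hn (by rw [h] at hw; exact hw.symm')) hadj hsv
    exact (step w w' v hw (fun h => hn (h ▸ Rel.rfl' G v)) h1.symm hsw).symm
  · intro hadj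
    cases hT : T v with
    | singleton => exact absurd ((hsing v).1 hT w hr).symm hne
    | clique => exact Or.inl rfl
    | indep => exact absurd hadj (((hindep v).1 hT).2.1 v w (Rel.rfl' G v) hr hne)
    | star =>
      refine Or.inr ⟨rfl, ?_⟩
      obtain ⟨_, c, hc, hx⟩ := (hstar v).1 hT
      by_cases hvc : v = c
      · subst hvc
        exact Or.inl ((hA v).2 ⟨hT, hx⟩)
      · obtain ⟨h1, h2⟩ := hx v (Rel.rfl' G v) hvc
        have hwc : w = c := leaf_unique h1 hadj h2
        have hTw : T w = FType.star := (hTconst v w hr).symm.trans hT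
        obtain ⟨_, d, hd, hy⟩ := (hstar w).1 hTw
        by_cases hwd : w = d
        · subst hwd
          exact Or.inr ((hA w).2 ⟨hTw, hy⟩)
        · exact (no_two_leaves hconn hcard hadj h1 (hy w (Rel.rfl' G w) hwd).1).elim
  · rintro (hT | ⟨_, hv | hw⟩)
    · exact ((hclique v).1 hT).2.1 v w (Rel.rfl' G v) hr hne
    · exact (((hA v).1 hv).2 w hr hne.symm).2.symm
    · exact (((hA w).1 hw).2 v hr.symm' hne).2

end Foliage
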